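/- Let n ≥ 2 be an integer, α ∈ ℝ with α ≠ 4-n, and set γ = (n-4+α)(n-α)/4 and h = ((n-4+α)/2)². Then for every integer k ≥ 0 and every ε > 0 there exists a function u : ℝⁿ → ℝ of class C² with compact support contained in ℝⁿ \ {0} such that ∫_{ℝⁿ} |x|^{α-2} |∇u(x)|² dx ≠ 0 and ∫_{ℝⁿ} |x|^α |Δu(x)|² dx < ( (γ + k(n-2+k))² / (h + k(n-2+k)) + ε ) ∫_{ℝⁿ} |x|^{α-2} |∇u(x)|² dx. (That is, δ_{n,α} ≤ (γ + k(n-2+k))²/(h + k(n-2+k)) for every k ≥ 0.) -/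

import Mathlib

open MeasureTheory

noncomputable def lap {n : ℕ} (u : EuclideanSpace ℝ (Fin n) → ℝ)
    (x : EuclideanSpace ℝ (Fin n)) : ℝ :=
  ∑ i : Fin n, iteratedFDeriv ℝ 2 u x ![EuclideanSpace.single i 1, EuclideanSpace.single i 1]

/-- Polar coordinates, with logarithmic radial variable, for the product of a radial function and
a homogeneous function. -/
theorem integral_log_norm_mul_homogeneous {n : ℕ} (hn : 1 ≤ n) (d : ℕ) (F : ℝ → ℝ)
    (G : EuclideanSpace ℝ (Fin n) → ℝ) (hG : ∀ (r : ℝ) x, 0 < r → G (r • x) = r ^ d * G x) :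
    ∫ x, F (Real.log ‖x‖) * G x =
      (∫ ω : Metric.sphere (0 : EuclideanSpace ℝ (Fin n)) 1, G ω ∂Measure.toSphere volume) *
        ∫ t : ℝ, Real.exp ((n + d) * t) * F t := by
  have : Nontrivial (EuclideanSpace ℝ (Fin n)) := by
    have : Nonempty (Fin n) := ⟨⟨0, hn⟩⟩
    infer_instance
  have hdim : Module.finrank ℝ (EuclideanSpace ℝ (Fin n)) = n := by simp
  have hrad : ∫ r : Set.Ioi (0 : ℝ), r.1 ^ d * F (Real.log r.1) ∂Measure.volumeIoiPow (n - 1) =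
      ∫ t : ℝ, Real.exp ((n + d) * t) * F t := by
    have h1 : ∫ r : Set.Ioi (0 : ℝ), r.1 ^ d * F (Real.log r.1) ∂Measure.volumeIoiPow (n - 1) =
        ∫ r in Set.Ioi (0 : ℝ), r ^ (n - 1) * (r ^ d * F (Real.log r)) := by
      simp only [Measure.volumeIoiPow, ENNReal.ofReal]
      rw [integral_withDensity_eq_integral_smul (by fun_prop),
        integral_subtype_comap measurableSet_Ioi fun a : ℝ ↦
          Real.toNNReal (a ^ (n - 1)) • (a ^ d * F (Real.log a))]
      refine setIntegral_congr_fun measurableSet_Ioi fun x hx ↦ ?_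
      simp only [NNReal.smul_def, smul_eq_mul]
      rw [Real.coe_toNNReal _ (pow_nonneg hx.out.le _)]
    have h2 := integral_image_eq_integral_abs_deriv_smul (s := Set.univ) (f := Real.exp)
      (f' := Real.exp) MeasurableSet.univ (fun x _ ↦ (Real.hasDerivAt_exp x).hasDerivWithinAt)
      Real.exp_injective.injOn (fun r ↦ r ^ (n - 1) * (r ^ d * F (Real.log r)))
    rw [h1, ← Real.range_exp, ← Set.image_univ, h2, setIntegral_univ]
    congr 1 with t
    rw [Real.log_exp, smul_eq_mul, abs_of_pos (Real.exp_pos t), ← mul_assoc, ← mul_assoc,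
      ← Real.exp_nat_mul, ← Real.exp_nat_mul, ← Real.exp_add, ← Real.exp_add, Nat.cast_sub hn]
    congr 2
    push_cast
    ring
  calc ∫ x, F (Real.log ‖x‖) * G x
      = ∫ x : ({0}ᶜ : Set (EuclideanSpace ℝ (Fin n))),
          F (Real.log ‖x.1‖) * G x.1 ∂(Measure.comap Subtype.val volume) := by
        rw [integral_subtype_comap (measurableSet_singleton _).compl
          fun x ↦ F (Real.log ‖x‖) * G x, restrict_compl_singleton]
    _ = ∫ p : Metric.sphere (0 : EuclideanSpace ℝ (Fin n)) 1 × Set.Ioi (0 : ℝ),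
          G p.1 * (p.2.1 ^ d * F (Real.log p.2.1))
          ∂((Measure.toSphere volume).prod (Measure.volumeIoiPow (n - 1))) := by
        have := (volume : Measure
          (EuclideanSpace ℝ (Fin n))).measurePreserving_homeomorphUnitSphereProd.integral_comp
            (Homeomorph.measurableEmbedding _)
            (fun p ↦ G p.1 * (p.2.1 ^ d * F (Real.log p.2.1)))
        rw [hdim] at this
        rw [← this]
        congr 1 with x
        have hx : 0 < ‖x.1‖ := norm_pos_iff.2 x.2
        have := hG ‖x.1‖ (‖x.1‖⁻¹ • x.1) hx
        rw [smul_inv_smul₀ hx.ne'] at this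
        simp only [homeomorphUnitSphereProd_apply_snd_coe, homeomorphUnitSphereProd_apply_fst_coe]
        rw [this]
        ring
    _ = _ := by
        rw [← hrad]
        exact integral_prod_mul
          (fun ω : Metric.sphere (0 : EuclideanSpace ℝ (Fin n)) 1 ↦ G ω)
          (fun r : Set.Ioi (0 : ℝ) ↦ r.1 ^ d * F (Real.log r.1))

/-- Smooth functions on the line with compact support contained in `[1, ∞)`, used as profiles of
`log ‖x‖`. Since `Real.log 0 = 0`, such a profile gives a function vanishing near the origin. -/
structure IsLogCutoff (f : ℝ → ℝ) : Prop where
  smooth : ContDiff ℝ (⊤ : ℕ∞) f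
  eq_zero_of_lt_one : ∀ t < 1, f t = 0
  eq_zero_of_large : ∃ M, ∀ t, M < t → f t = 0

namespace IsLogCutoff

variable {f g : ℝ → ℝ}

theorem deriv (hf : IsLogCutoff f) : IsLogCutoff (deriv f) where
  smooth := (contDiff_infty_iff_deriv.1 hf.smooth).2
  eq_zero_of_lt_one t ht := by
    have : f =ᶠ[nhds t] fun _ ↦ 0 := by
      filter_upwards [Iio_mem_nhds ht] with s hs using hf.eq_zero_of_lt_one s hs
    simp [this.deriv_eq]
  eq_zero_of_large := by
    obtain ⟨M, hM⟩ := hf.eq_zero_of_large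
    refine ⟨M, fun t ht ↦ ?_⟩
    have : f =ᶠ[nhds t] fun _ ↦ 0 := by
      filter_upwards [Ioi_mem_nhds ht] with s hs using hM s hs
    simp [this.deriv_eq]

theorem smooth_mul (hf : IsLogCutoff f) (hg : ContDiff ℝ (⊤ : ℕ∞) g) :
    IsLogCutoff fun t ↦ g t * f t where
  smooth := hg.mul hf.smooth
  eq_zero_of_lt_one t ht := by simp [hf.eq_zero_of_lt_one t ht]
  eq_zero_of_large := hf.eq_zero_of_large.imp fun M hM t ht ↦ by simp [hM t ht]

theorem add (hf : IsLogCutoff f) (hg : IsLogCutoff g) : IsLogCutoff fun t ↦ f t + g t where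
  smooth := hf.smooth.add hg.smooth
  eq_zero_of_lt_one t ht := by simp [hf.eq_zero_of_lt_one t ht, hg.eq_zero_of_lt_one t ht]
  eq_zero_of_large := by
    obtain ⟨M, hM⟩ := hf.eq_zero_of_large
    obtain ⟨N, hN⟩ := hg.eq_zero_of_large
    refine ⟨max M N, fun t ht ↦ ?_⟩
    simp [hM t (lt_of_le_of_lt (le_max_left _ _) ht), hN t (lt_of_le_of_lt (le_max_right _ _) ht)]

theorem hasDerivAt (hf : IsLogCutoff f) (t : ℝ) : HasDerivAt f (_root_.deriv f t) t :=
  ((hf.smooth.differentiable (by simp)) t).hasDerivAt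

theorem integrable (hf : IsLogCutoff f) : Integrable f := by
  refine hf.smooth.continuous.integrable_of_hasCompactSupport ?_
  obtain ⟨M, hM⟩ := hf.eq_zero_of_large
  refine HasCompactSupport.intro (isCompact_Icc (a := (1 : ℝ)) (b := M)) fun t ht ↦ ?_
  by_cases h : t < 1
  · exact hf.eq_zero_of_lt_one t h
  · exact hM t (by by_contra h'; exact ht ⟨not_lt.1 h, not_lt.1 h'⟩)

theorem integral_deriv (hf : IsLogCutoff f) : ∫ t, _root_.deriv f t = 0 :=
  integral_eq_zero_of_hasDerivAt_of_integrable hf.hasDerivAt hf.deriv.integrable hf.integrable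

theorem eq_zero_of_norm_le {V : Type*} [SeminormedAddCommGroup V] (hf : IsLogCutoff f) {x : V}
    (hx : ‖x‖ ≤ 1) : f (Real.log ‖x‖) = 0 :=
  hf.eq_zero_of_lt_one _ (by linarith [Real.log_nonpos (norm_nonneg x) hx])

theorem comp_log_norm_eventuallyEq_zero {V : Type*} [SeminormedAddCommGroup V]
    (hf : IsLogCutoff f) : (fun y : V ↦ f (Real.log ‖y‖)) =ᶠ[nhds 0] fun _ ↦ 0 := by
  filter_upwards [Metric.ball_mem_nhds (0 : V) one_pos] with y hy
  exact hf.eq_zero_of_norm_le (mem_ball_zero_iff.1 hy).le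

theorem rpow_norm_mul {V : Type*} [NormedAddCommGroup V] (hf : IsLogCutoff f) (a : ℝ) (x : V) :
    ‖x‖ ^ a * f (Real.log ‖x‖) = Real.exp (a * Real.log ‖x‖) * f (Real.log ‖x‖) := by
  rcases eq_or_ne x 0 with rfl | hx
  · rw [hf.eq_zero_of_norm_le (by simp), mul_zero, mul_zero]
  · rw [Real.rpow_def_of_pos (norm_pos_iff.2 hx), mul_comm a]

theorem norm_sq_mul_exp {V : Type*} [NormedAddCommGroup V] (hf : IsLogCutoff f) (x : V) :
    ‖x‖ ^ 2 * Real.exp (-2 * Real.log ‖x‖) * f (Real.log ‖x‖) = f (Real.log ‖x‖) := by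
  rcases eq_or_ne x 0 with rfl | hx
  · rw [hf.eq_zero_of_norm_le (by simp), mul_zero]
  · have hx' := norm_pos_iff.2 hx
    rw [mul_comm (-2 : ℝ), ← Real.rpow_def_of_pos hx', ← Real.rpow_natCast, ← Real.rpow_add hx']
    simp

theorem zero_notMem_tsupport {V : Type*} [NormedAddCommGroup V] (hf : IsLogCutoff f) (G : V → ℝ) :
    (0 : V) ∉ tsupport fun x : V ↦ f (Real.log ‖x‖) * G x := by
  rw [notMem_tsupport_iff_eventuallyEq]
  filter_upwards [hf.comp_log_norm_eventuallyEq_zero (V := V)] with x hx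
  simp [hx]

variable {V : Type*} [NormedAddCommGroup V] [InnerProductSpace ℝ V]

/-- The chain rule for a profile of `log ‖x‖` that vanishes near the origin. -/
theorem hasFDerivAt_comp_log_norm (hf : IsLogCutoff f) (x : V) :
    HasFDerivAt (fun y : V ↦ f (Real.log ‖y‖))
      ((Real.exp (-2 * Real.log ‖x‖) * _root_.deriv f (Real.log ‖x‖)) • innerSL ℝ x) x := by
  rcases eq_or_ne x 0 with rfl | hx
  · simpa using (hasFDerivAt_const (0 : ℝ) (0 : V)).congr_of_eventuallyEq
      hf.comp_log_norm_eventuallyEq_zero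
  · have hx' : 0 < ‖x‖ := norm_pos_iff.2 hx
    have h1 := ((hasStrictFDerivAt_norm_sq x).hasFDerivAt.log (by positivity)).mul_const
      (1 / 2 : ℝ)
    have h2 : (fun y : V ↦ Real.log (‖y‖ ^ 2) * (1 / 2)) = fun y ↦ Real.log ‖y‖ := by
      ext y
      rw [Real.log_pow]
      push_cast
      ring
    have h3 : Real.exp (-2 * Real.log ‖x‖) = (‖x‖ ^ 2)⁻¹ := by
      rw [mul_comm, ← Real.rpow_def_of_pos hx', Real.rpow_neg hx'.le]
      simp
    rw [h2] at h1
    convert! (hf.hasDerivAt (Real.log ‖x‖)).comp_hasFDerivAt x h1 using 1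
    ext y
    simp only [h3, smul_apply, smul_eq_mul, innerSL_apply_apply, nsmul_eq_mul]
    push_cast
    ring

theorem contDiff_comp_log_norm (hf : IsLogCutoff f) :
    ContDiff ℝ (⊤ : ℕ∞) fun x : V ↦ f (Real.log ‖x‖) := by
  refine contDiff_iff_contDiffAt.2 fun x ↦ ?_
  rcases eq_or_ne x 0 with rfl | hx
  · exact contDiffAt_const.congr_of_eventuallyEq hf.comp_log_norm_eventuallyEq_zero
  · exact hf.smooth.contDiffAt.comp x ((contDiffAt_norm ℝ hx).log (norm_ne_zero_iff.2 hx))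

theorem hasCompactSupport [FiniteDimensional ℝ V] (hf : IsLogCutoff f) (G : V → ℝ) :
    HasCompactSupport fun x : V ↦ f (Real.log ‖x‖) * G x := by
  obtain ⟨M, hM⟩ := hf.eq_zero_of_large
  have := FiniteDimensional.proper_real V
  refine HasCompactSupport.intro (isCompact_closedBall (0 : V) (Real.exp M)) fun x hx ↦ ?_
  have hx' : Real.exp M < ‖x‖ := by simpa using hx
  rw [hM _ ((Real.lt_log_iff_exp_lt (lt_trans (Real.exp_pos M) hx')).2 hx'), zero_mul]

theorem integrable_comp_log_norm_mul [FiniteDimensional ℝ V] [MeasurableSpace V] [BorelSpace V]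
    (hf : IsLogCutoff f) {G : V → ℝ} (hG : Continuous G) :
    Integrable fun x : V ↦ f (Real.log ‖x‖) * G x :=
  (hf.contDiff_comp_log_norm.continuous.mul hG).integrable_of_hasCompactSupport
    (hf.hasCompactSupport G)

end IsLogCutoff

section Laplacian

variable {n : ℕ}

theorem lap_eq_sum_fderiv {u : EuclideanSpace ℝ (Fin n) → ℝ} (hu : ContDiff ℝ 2 u)
    (x : EuclideanSpace ℝ (Fin n)) :
    lap u x = ∑ i, fderiv ℝ (fun y ↦ fderiv ℝ u y (EuclideanSpace.single i 1)) x
      (EuclideanSpace.single i 1) := by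
  have h : DifferentiableAt ℝ (fderiv ℝ u) x :=
    (hu.fderiv_right (m := 1) (by norm_num)).differentiable (by simp) x
  refine Finset.sum_congr rfl fun i _ ↦ ?_
  rw [iteratedFDeriv_two_apply, fderiv_clm_apply h (differentiableAt_const _)]
  simp

theorem sum_fderiv_single_mul (L : EuclideanSpace ℝ (Fin n) →L[ℝ] ℝ)
    (x : EuclideanSpace ℝ (Fin n)) :
    ∑ i, x i * L (EuclideanSpace.single i 1) = L x := by
  conv_rhs => rw [← (EuclideanSpace.basisFun (Fin n) ℝ).sum_repr x, map_sum]
  simp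

theorem norm_gradient_sq (u : EuclideanSpace ℝ (Fin n) → ℝ) (x : EuclideanSpace ℝ (Fin n)) :
    ‖gradient u x‖ ^ 2 = ∑ i, fderiv ℝ u x (EuclideanSpace.single i 1) ^ 2 := by
  rw [EuclideanSpace.norm_sq_eq]
  refine Finset.sum_congr rfl fun i _ ↦ ?_
  rw [Real.norm_eq_abs, sq_abs]
  congr 1
  rw [← InnerProductSpace.toDual_symm_apply (𝕜 := ℝ), EuclideanSpace.inner_single_right]
  simp [gradient]

theorem integral_lap_eq_zero {u : EuclideanSpace ℝ (Fin n) → ℝ} (hu : ContDiff ℝ 2 u)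
    (hc : HasCompactSupport u) : ∫ x, lap u x = 0 := by
  have h1 (i : Fin n) : ContDiff ℝ 1 fun y ↦ fderiv ℝ u y (EuclideanSpace.single i 1) :=
    (hu.fderiv_right (m := 1) (by norm_num)).clm_apply contDiff_const
  have hc1 (i : Fin n) : HasCompactSupport fun y ↦ fderiv ℝ u y (EuclideanSpace.single i 1) :=
    hc.fderiv_apply ℝ _
  have h2 (i : Fin n) : Continuous fun x ↦
      fderiv ℝ (fun y ↦ fderiv ℝ u y (EuclideanSpace.single i 1)) x (EuclideanSpace.single i 1) :=
    ((h1 i).continuous_fderiv (by simp)).clm_apply continuous_const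
  have hi (i : Fin n) : Integrable fun x ↦
      fderiv ℝ (fun y ↦ fderiv ℝ u y (EuclideanSpace.single i 1)) x (EuclideanSpace.single i 1) :=
    (h2 i).integrable_of_hasCompactSupport ((hc1 i).fderiv_apply ℝ _)
  simp_rw [lap_eq_sum_fderiv hu]
  rw [integral_finsetSum _ fun i _ ↦ hi i]
  refine Finset.sum_eq_zero fun i _ ↦ ?_
  have := integral_mul_fderiv_eq_neg_fderiv_mul_of_integrable (𝕜 := ℝ)
    (μ := (volume : Measure (EuclideanSpace ℝ (Fin n)))) (f := fun _ ↦ (1 : ℝ))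
    (g := fun y ↦ fderiv ℝ u y (EuclideanSpace.single i 1)) (v := EuclideanSpace.single i 1)
    (by simp) (by simpa using hi i)
    (by simpa using (h1 i).continuous.integrable_of_hasCompactSupport (hc1 i))
    (by fun_prop) fun x _ ↦ (h1 i).differentiable (by simp) x
  simpa using this

variable {f : ℝ → ℝ} {Q : EuclideanSpace ℝ (Fin n) → ℝ} {d : ℝ}

theorem fderiv_log_norm_mul (hf : IsLogCutoff f) (hQ : ContDiff ℝ 2 Q)
    (x v : EuclideanSpace ℝ (Fin n)) :
    fderiv ℝ (fun y ↦ f (Real.log ‖y‖) * Q y) x v =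
      Real.exp (-2 * Real.log ‖x‖) * deriv f (Real.log ‖x‖) * inner ℝ x v * Q x +
        f (Real.log ‖x‖) * fderiv ℝ Q x v := by
  rw [((hf.hasFDerivAt_comp_log_norm x).fun_mul
    (hQ.differentiable (by simp) x).hasFDerivAt).fderiv]
  simp
  ring

theorem contDiff_log_norm_mul (hf : IsLogCutoff f) (hQ : ContDiff ℝ 2 Q) :
    ContDiff ℝ 2 fun y ↦ f (Real.log ‖y‖) * Q y :=
  (by exact_mod_cast contDiff_infty.1 hf.contDiff_comp_log_norm 2 : ContDiff ℝ 2 _).mul hQ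

/-- The Laplacian of the product of a radial function and a function satisfying Euler's identity
for homogeneous functions of degree `d`. -/
theorem lap_log_norm_mul (hf : IsLogCutoff f) (hQ : ContDiff ℝ 2 Q)
    (hd : ∀ x, fderiv ℝ Q x x = d * Q x) (x : EuclideanSpace ℝ (Fin n)) :
    lap (fun y ↦ f (Real.log ‖y‖) * Q y) x =
      Real.exp (-2 * Real.log ‖x‖) * (deriv (deriv f) (Real.log ‖x‖) +
        (n - 2 + 2 * d) * deriv f (Real.log ‖x‖)) * Q x + f (Real.log ‖x‖) * lap Q x := by
  set g : ℝ → ℝ := fun t ↦ Real.exp (-2 * t) * deriv f t with hg_def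
  have hg : IsLogCutoff g := hf.deriv.smooth_mul (by fun_prop)
  have hg' (t : ℝ) : deriv g t = Real.exp (-2 * t) * (deriv (deriv f) t - 2 * deriv f t) := by
    have h1 : HasDerivAt (fun t : ℝ ↦ Real.exp (-2 * t)) (Real.exp (-2 * t) * (-2)) t := by
      simpa using ((hasDerivAt_id t).const_mul (-2 : ℝ)).exp
    rw [(h1.fun_mul (hf.deriv.hasDerivAt t)).deriv]
    ring
  have hQi (i : Fin n) : ContDiff ℝ 1 fun y ↦ fderiv ℝ Q y (EuclideanSpace.single i 1) :=
    (hQ.fderiv_right (m := 1) (by norm_num)).clm_apply contDiff_const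
  have key (i : Fin n) : fderiv ℝ (fun y ↦ fderiv ℝ (fun y ↦ f (Real.log ‖y‖) * Q y) y
      (EuclideanSpace.single i 1)) x (EuclideanSpace.single i 1) =
      Real.exp (-2 * Real.log ‖x‖) * deriv g (Real.log ‖x‖) * x i ^ 2 * Q x +
        g (Real.log ‖x‖) * Q x +
        2 * g (Real.log ‖x‖) * (x i * fderiv ℝ Q x (EuclideanSpace.single i 1)) +
        f (Real.log ‖x‖) * fderiv ℝ (fun y ↦ fderiv ℝ Q y (EuclideanSpace.single i 1)) x
          (EuclideanSpace.single i 1) := by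
    have h1 : (fun y ↦ fderiv ℝ (fun y ↦ f (Real.log ‖y‖) * Q y) y
        (EuclideanSpace.single i 1)) = fun y ↦ g (Real.log ‖y‖) * (y i * Q y) +
          f (Real.log ‖y‖) * fderiv ℝ Q y (EuclideanSpace.single i 1) := by
      ext y
      rw [fderiv_log_norm_mul hf hQ]
      simp [hg_def, EuclideanSpace.inner_single_right]
      ring
    have hi : HasFDerivAt (fun y : EuclideanSpace ℝ (Fin n) ↦ y i)
        (EuclideanSpace.proj i : EuclideanSpace ℝ (Fin n) →L[ℝ] ℝ) x :=
      (EuclideanSpace.proj i : EuclideanSpace ℝ (Fin n) →L[ℝ] ℝ).hasFDerivAt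
    have h2 := ((hg.hasFDerivAt_comp_log_norm x).fun_mul
      (hi.fun_mul (hQ.differentiable (by simp) x).hasFDerivAt)).fun_add
      ((hf.hasFDerivAt_comp_log_norm x).fun_mul
        ((hQi i).differentiable (by simp) x).hasFDerivAt)
    rw [h1, h2.fderiv]
    simp [hg_def, EuclideanSpace.inner_single_right]
    ring
  rw [lap_eq_sum_fderiv (contDiff_log_norm_mul hf hQ), lap_eq_sum_fderiv hQ]
  simp_rw [key]
  rw [Finset.sum_add_distrib, Finset.sum_add_distrib, Finset.sum_add_distrib, ← Finset.mul_sum,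
    ← Finset.mul_sum, ← Finset.mul_sum, sum_fderiv_single_mul, hd, ← Finset.sum_mul,
    ← Finset.mul_sum]
  have hx : ∑ i, x i ^ 2 = ‖x‖ ^ 2 := by simp [EuclideanSpace.norm_sq_eq]
  have h3 := hg.deriv.norm_sq_mul_exp x
  rw [hx]
  simp only [Finset.sum_const, Finset.card_univ, Fintype.card_fin, nsmul_eq_mul]
  rw [hg'] at h3 ⊢
  simp only [hg_def]
  linear_combination Q x * h3

theorem lap_sq (hQ : ContDiff ℝ 2 Q) (x : EuclideanSpace ℝ (Fin n)) :
    lap (fun y ↦ Q y ^ 2) x =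
      2 * Q x * lap Q x + 2 * ∑ i, fderiv ℝ Q x (EuclideanSpace.single i 1) ^ 2 := by
  have hQd (y) : HasFDerivAt Q (fderiv ℝ Q y) y := (hQ.differentiable (by simp) y).hasFDerivAt
  have h1 (i : Fin n) : (fun y ↦ fderiv ℝ (fun y ↦ Q y ^ 2) y (EuclideanSpace.single i 1)) =
      fun y ↦ 2 * Q y * fderiv ℝ Q y (EuclideanSpace.single i 1) := by
    ext y
    rw [((hQd y).pow 2).fderiv]
    simp
  have hQi (i : Fin n) : ContDiff ℝ 1 fun y ↦ fderiv ℝ Q y (EuclideanSpace.single i 1) :=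
    (hQ.fderiv_right (m := 1) (by norm_num)).clm_apply contDiff_const
  rw [lap_eq_sum_fderiv (hQ.pow 2), lap_eq_sum_fderiv hQ, Finset.mul_sum, Finset.mul_sum,
    ← Finset.sum_add_distrib]
  refine Finset.sum_congr rfl fun i _ ↦ ?_
  rw [h1, (((hQd x).const_mul 2).fun_mul ((hQi i).differentiable (by simp) x).hasFDerivAt).fderiv]
  simp
  ring

/-- The squared gradient of the product of a radial function and a function satisfying Euler's
identity for homogeneous functions of degree `d`. -/
theorem norm_gradient_log_norm_mul_sq (hf : IsLogCutoff f) (hQ : ContDiff ℝ 2 Q)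
    (hd : ∀ x, fderiv ℝ Q x x = d * Q x) (x : EuclideanSpace ℝ (Fin n)) :
    ‖gradient (fun y ↦ f (Real.log ‖y‖) * Q y) x‖ ^ 2 =
      Real.exp (-2 * Real.log ‖x‖) * (deriv f (Real.log ‖x‖) ^ 2 +
        2 * d * (f (Real.log ‖x‖) * deriv f (Real.log ‖x‖))) * Q x ^ 2 +
      Real.exp (-2 * Real.log ‖x‖) * f (Real.log ‖x‖) ^ 2 *
        (‖x‖ ^ 2 * ∑ i, fderiv ℝ Q x (EuclideanSpace.single i 1) ^ 2) := by
  have key (i : Fin n) : fderiv ℝ (fun y ↦ f (Real.log ‖y‖) * Q y) x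
      (EuclideanSpace.single i 1) ^ 2 =
      (Real.exp (-2 * Real.log ‖x‖) * deriv f (Real.log ‖x‖) * Q x) ^ 2 * x i ^ 2 +
      2 * Real.exp (-2 * Real.log ‖x‖) * deriv f (Real.log ‖x‖) * Q x * f (Real.log ‖x‖) *
        (x i * fderiv ℝ Q x (EuclideanSpace.single i 1)) +
      f (Real.log ‖x‖) ^ 2 * fderiv ℝ Q x (EuclideanSpace.single i 1) ^ 2 := by
    rw [fderiv_log_norm_mul hf hQ]
    simp only [EuclideanSpace.inner_single_right]
    simp
    ring
  rw [norm_gradient_sq]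
  simp_rw [key]
  rw [Finset.sum_add_distrib, Finset.sum_add_distrib, ← Finset.mul_sum,
    ← Finset.mul_sum, sum_fderiv_single_mul, hd, ← Finset.mul_sum]
  have hx : ∑ i, x i ^ 2 = ‖x‖ ^ 2 := by simp [EuclideanSpace.norm_sq_eq]
  rw [hx]
  have h1 := hf.norm_sq_mul_exp x
  have h2 := hf.deriv.norm_sq_mul_exp x
  linear_combination (Real.exp (-2 * Real.log ‖x‖) * deriv f (Real.log ‖x‖) * Q x ^ 2) * h2 -
    f (Real.log ‖x‖) * (∑ i, fderiv ℝ Q x (EuclideanSpace.single i 1) ^ 2) * h1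

end Laplacian

theorem hasDerivAt_exp_mul_mul {f : ℝ → ℝ} {f' t : ℝ} (hf : HasDerivAt f f' t) (β : ℝ) :
    HasDerivAt (fun t ↦ Real.exp (β * t) * f t) (Real.exp (β * t) * (f' + β * f t)) t := by
  have h1 : HasDerivAt (fun t : ℝ ↦ Real.exp (β * t)) (Real.exp (β * t) * β) t := by
    simpa using ((hasDerivAt_id t).const_mul β).exp
  convert! h1.fun_mul hf using 1
  ring

namespace IsLogCutoff

variable {f : ℝ → ℝ}

theorem exp_mul (hf : IsLogCutoff f) (β : ℝ) : IsLogCutoff fun t ↦ Real.exp (β * t) * f t :=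
  hf.smooth_mul (by fun_prop)

theorem deriv_exp_mul (hf : IsLogCutoff f) (β : ℝ) :
    _root_.deriv (fun t ↦ Real.exp (β * t) * f t) =
      fun t ↦ Real.exp (β * t) * (_root_.deriv f t + β * f t) :=
  funext fun t ↦ (hasDerivAt_exp_mul_mul (hf.hasDerivAt t) β).deriv

theorem deriv_deriv_exp_mul (hf : IsLogCutoff f) (β : ℝ) :
    _root_.deriv (_root_.deriv (fun t ↦ Real.exp (β * t) * f t)) =
      fun t ↦ Real.exp (β * t) *
        (_root_.deriv (_root_.deriv f) t + 2 * β * _root_.deriv f t + β ^ 2 * f t) := by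
  rw [hf.deriv_exp_mul]
  ext t
  rw [(hasDerivAt_exp_mul_mul ((hf.deriv.hasDerivAt t).fun_add
    ((hf.hasDerivAt t).const_mul β)) β).deriv]
  ring

theorem comp_mul_left (hf : IsLogCutoff f) {s : ℝ} (hs : 0 < s) (hs1 : s ≤ 1) :
    IsLogCutoff fun t ↦ f (s * t) where
  smooth := hf.smooth.comp (by fun_prop)
  eq_zero_of_lt_one t ht := hf.eq_zero_of_lt_one _ (by nlinarith)
  eq_zero_of_large := by
    obtain ⟨M, hM⟩ := hf.eq_zero_of_large
    exact ⟨M / s, fun t ht ↦ hM _ (by rwa [div_lt_iff₀' hs] at ht)⟩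

end IsLogCutoff

theorem exists_isLogCutoff : ∃ f, IsLogCutoff f ∧ 0 < ∫ t, f t ∧ 0 < ∫ t, f t ^ 2 := by
  let b : ContDiffBump (3 / 2 : ℝ) := ⟨1 / 4, 1 / 2, by norm_num, by norm_num⟩
  have hb (t : ℝ) (ht : 1 / 2 ≤ |t - 3 / 2|) : b t = 0 :=
    b.zero_of_le_dist (by rwa [Real.dist_eq])
  refine ⟨b, ⟨b.contDiff, fun t ht ↦ hb t ?_, 2, fun t ht ↦ hb t ?_⟩, b.integral_pos, ?_⟩
  · rw [abs_of_neg (by linarith)]; linarith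
  · rw [abs_of_pos (by linarith)]; linarith
  · refine (b.continuous.pow 2).integral_pos_of_hasCompactSupport_nonneg_nonzero (x := 3 / 2)
      ?_ (fun t ↦ sq_nonneg (b t)) ?_
    · exact b.hasCompactSupport.comp_left (g := fun y : ℝ ↦ y ^ 2) (by simp)
    · have : b (3 / 2) = 1 := b.one_of_mem_closedBall (Metric.mem_closedBall_self (by norm_num))
      simp [this]

section Homogeneous

variable {n : ℕ} {P : EuclideanSpace ℝ (Fin n) → ℝ} {k : ℕ}

theorem fderiv_apply_self_of_homogeneous (hP : ContDiff ℝ 2 P)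
    (hk : ∀ (r : ℝ) x, P (r • x) = r ^ k * P x) (x : EuclideanSpace ℝ (Fin n)) :
    fderiv ℝ P x x = k * P x := by
  have h1 : HasDerivAt (fun r : ℝ ↦ r • x) x 1 := by
    simpa using (hasDerivAt_id (1 : ℝ)).smul_const x
  have h2 : HasFDerivAt P (fderiv ℝ P x) ((1 : ℝ) • x) := by
    rw [one_smul]
    exact (hP.differentiable (by simp) x).hasFDerivAt
  have h3 := h2.comp_hasDerivAt (1 : ℝ) h1
  have h4 : HasDerivAt (fun r : ℝ ↦ r ^ k * P x) (k * P x) 1 := by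
    simpa using (hasDerivAt_pow k (1 : ℝ)).mul_const (P x)
  refine h3.unique ?_
  convert! h4 using 1
  ext r
  exact hk r x

theorem sum_fderiv_sq_of_homogeneous (hk : ∀ (r : ℝ) x, P (r • x) = r ^ k * P x) (r : ℝ)
    (x : EuclideanSpace ℝ (Fin n)) :
    r ^ 2 * ∑ i, fderiv ℝ P (r • x) (EuclideanSpace.single i 1) ^ 2 =
      r ^ (2 * k) * ∑ i, fderiv ℝ P x (EuclideanSpace.single i 1) ^ 2 := by
  have h : r • fderiv ℝ P (r • x) = r ^ k • fderiv ℝ P x := by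
    rw [← fderiv_comp_smul, funext (hk r)]
    exact congrFun (fderiv_const_smul_field (r ^ k)) x
  rw [Finset.mul_sum, Finset.mul_sum]
  refine Finset.sum_congr rfl fun i _ ↦ ?_
  have := congrArg (fun L ↦ L (EuclideanSpace.single i 1)) h
  simp only [smul_apply, smul_eq_mul] at this
  rw [← mul_pow, this]
  ring

/-- The spherical integral of the Laplacian of a homogeneous function. -/
theorem integral_sphere_lap (hn : 1 ≤ n) (hP : ContDiff ℝ 2 P)
    (hk : ∀ (r : ℝ) x, P (r • x) = r ^ k * P x)
    (hL : ∀ (r : ℝ) x, 0 < r → ‖r • x‖ ^ 2 * lap P (r • x) = r ^ k * (‖x‖ ^ 2 * lap P x)) :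
    ∫ ω : Metric.sphere (0 : EuclideanSpace ℝ (Fin n)) 1,
        ‖(ω : EuclideanSpace ℝ (Fin n))‖ ^ 2 * lap P ω ∂Measure.toSphere volume =
      k * (n + k - 2) * ∫ ω : Metric.sphere (0 : EuclideanSpace ℝ (Fin n)) 1,
        P ω ∂Measure.toSphere volume := by
  obtain ⟨f, hf, hpos, -⟩ := exists_isLogCutoff
  set β : ℝ := 2 - n - k with hβ
  set g : ℝ → ℝ := fun t ↦ Real.exp (β * t) * f t with hg_def
  have hg : IsLogCutoff g := hf.exp_mul β
  have hcl : Continuous (lap P) := by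
    unfold lap
    refine continuous_finsetSum _ fun i _ ↦ ?_
    simp_rw [iteratedFDeriv_two_apply]
    have h1 : Continuous (fderiv ℝ (fderiv ℝ P)) :=
      (hP.fderiv_right (m := 1) (by norm_num)).continuous_fderiv (by simp)
    fun_prop
  have h0 := integral_lap_eq_zero (contDiff_log_norm_mul hg hP) (hg.hasCompactSupport P)
  set F : ℝ → ℝ := fun t ↦ Real.exp ((β - 2) * t) * (deriv (deriv f) t +
    ((2 - n) * deriv f t + -(k * (n + k - 2)) * f t)) with hF
  set H : ℝ → ℝ := fun t ↦ Real.exp ((β - 2) * t) * f t with hH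
  have hFc : IsLogCutoff F :=
    (hf.deriv.deriv.add ((hf.deriv.smooth_mul contDiff_const).add
      (hf.smooth_mul contDiff_const))).exp_mul _
  have hHc : IsLogCutoff H := hf.exp_mul _
  have hexp (t : ℝ) : Real.exp (-2 * t) * Real.exp (β * t) = Real.exp ((β - 2) * t) := by
    rw [← Real.exp_add]; ring_nf
  have hlap (x : EuclideanSpace ℝ (Fin n)) : lap (fun y ↦ g (Real.log ‖y‖) * P y) x =
      F (Real.log ‖x‖) * P x + H (Real.log ‖x‖) * (‖x‖ ^ 2 * lap P x) := by
    rw [lap_log_norm_mul hg hP (fderiv_apply_self_of_homogeneous hP hk), hg_def,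
      hf.deriv_deriv_exp_mul, hf.deriv_exp_mul]
    have := hg.norm_sq_mul_exp x
    simp only [hg_def, hF, hH, ← hexp] at this ⊢
    rw [hβ] at this ⊢
    linear_combination -lap P x * this
  simp_rw [hlap] at h0
  rw [integral_add (hFc.integrable_comp_log_norm_mul hP.continuous)
    (hHc.integrable_comp_log_norm_mul (by fun_prop)),
    integral_log_norm_mul_homogeneous hn k F P (fun r x _ ↦ hk r x),
    integral_log_norm_mul_homogeneous hn k H (fun x ↦ ‖x‖ ^ 2 * lap P x) hL] at h0
  have hexp' (t : ℝ) : Real.exp ((n + k) * t) * Real.exp ((β - 2) * t) = 1 := by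
    rw [← Real.exp_add, hβ, ← Real.exp_zero]; ring_nf
  have hIF : ∫ t, Real.exp ((n + k) * t) * F t = -(k * (n + k - 2)) * ∫ t, f t := by
    simp only [hF, ← mul_assoc, hexp', one_mul]
    rw [integral_add hf.deriv.deriv.integrable ((hf.deriv.smooth_mul contDiff_const).add
      (hf.smooth_mul contDiff_const)).integrable, integral_add (hf.deriv.integrable.const_mul _)
      (hf.integrable.const_mul _), integral_const_mul, integral_const_mul,
      hf.integral_deriv, hf.deriv.integral_deriv]
    ring
  have hIH : ∫ t, Real.exp ((n + k) * t) * H t = ∫ t, f t := by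
    simp only [hH, ← mul_assoc, hexp', one_mul]
  rw [hIF, hIH] at h0
  refine mul_right_cancel₀ hpos.ne' ?_
  linear_combination h0

end Homogeneous

theorem exists_harmonic_homogeneous {n : ℕ} (hn : 2 ≤ n) (k : ℕ) :
    ∃ P : EuclideanSpace ℝ (Fin n) → ℝ, ContDiff ℝ 2 P ∧
      (∀ (r : ℝ) x, P (r • x) = r ^ k * P x) ∧ (∀ x, lap P x = 0) ∧ ∃ x, ‖x‖ = 1 ∧ P x ≠ 0 := by
  obtain ⟨m, rfl⟩ := Nat.exists_eq_add_of_le' hn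
  let z : EuclideanSpace ℝ (Fin (m + 2)) →L[ℝ] ℂ :=
    Complex.ofRealCLM ∘L EuclideanSpace.proj 0 +
      Complex.I • (Complex.ofRealCLM ∘L EuclideanSpace.proj 1)
  have hz (x) : z x = x 0 + Complex.I * x 1 := by simp [z]
  have hsum : ∑ i, z (EuclideanSpace.single i 1) ^ 2 = 0 := by
    rw [Fin.sum_univ_succ, Fin.sum_univ_succ]
    simp [hz, Fin.ext_iff]
  have hd (j : ℕ) (c : ℂ) (x v : EuclideanSpace ℝ (Fin (m + 2))) :
      fderiv ℝ (fun y ↦ (c * z y ^ j).re) x v = (c * (j * z x ^ (j - 1) * z v)).re := by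
    have h := (Complex.reCLM.hasFDerivAt.comp x ((z.hasFDerivAt.pow j).const_mul c))
    have h' := congrArg (fun L ↦ L v) h.fderiv
    simp only [Function.comp_def, Complex.reCLM_apply] at h'
    rw [h']
    simp
  have hs : ContDiff ℝ 2 fun y ↦ (z y ^ k).re :=
    Complex.reCLM.contDiff.comp (z.contDiff.pow k)
  refine ⟨fun y ↦ (z y ^ k).re, hs, fun r x ↦ ?_, fun x ↦ ?_, EuclideanSpace.single 0 1,
    by simp, ?_⟩
  · simp only []
    rw [map_smul, smul_pow, Complex.smul_re, smul_eq_mul]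
  · rw [lap_eq_sum_fderiv hs]
    have h1 (i : Fin (m + 2)) : (fun y ↦ fderiv ℝ (fun y ↦ (z y ^ k).re) y
        (EuclideanSpace.single i 1)) =
        fun y ↦ (k * z (EuclideanSpace.single i 1) * z y ^ (k - 1)).re := by
      ext y
      have := hd k 1 y (EuclideanSpace.single i 1)
      simp only [one_mul] at this
      rw [this]
      ring_nf
    simp_rw [h1, hd]
    rw [← Complex.re_sum]
    have h2 : ∑ i, k * z (EuclideanSpace.single i 1) *
        ((k - 1 : ℕ) * z x ^ (k - 1 - 1) * z (EuclideanSpace.single i 1)) =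
        k * (k - 1 : ℕ) * z x ^ (k - 1 - 1) * ∑ i, z (EuclideanSpace.single i 1) ^ 2 := by
      rw [Finset.mul_sum]
      exact Finset.sum_congr rfl fun i _ ↦ by ring
    rw [h2, hsum, mul_zero, Complex.zero_re]
  · simp [hz]

section Energy

variable {n : ℕ} {P : EuclideanSpace ℝ (Fin n) → ℝ} {k : ℕ} {f : ℝ → ℝ} {α β : ℝ}

theorem integral_rpow_mul_lap_sq (hn : 1 ≤ n) (hP : ContDiff ℝ 2 P)
    (hk : ∀ (r : ℝ) x, P (r • x) = r ^ k * P x) (hlap : ∀ x, lap P x = 0) (hf : IsLogCutoff f)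
    (hβ : α - 4 + n + 2 * k + 2 * β = 0) :
    ∫ x, ‖x‖ ^ α *
        lap (fun y ↦ (fun t ↦ Real.exp (β * t) * f t) (Real.log ‖y‖) * P y) x ^ 2 =
      (∫ ω : Metric.sphere (0 : EuclideanSpace ℝ (Fin n)) 1, P ω ^ 2 ∂Measure.toSphere volume) *
        ∫ t, (deriv (deriv f) t + (n - 2 + 2 * k + 2 * β) * deriv f t +
          β * (β + (n - 2 + 2 * k)) * f t) ^ 2 := by
  set g : ℝ → ℝ := fun t ↦ Real.exp (β * t) * f t with hg_def
  have hg : IsLogCutoff g := hf.exp_mul β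
  set F : ℝ → ℝ := fun t ↦ Real.exp ((β - 2) * t) * (deriv (deriv f) t +
    ((n - 2 + 2 * k + 2 * β) * deriv f t + β * (β + (n - 2 + 2 * k)) * f t)) with hF
  have hFc : IsLogCutoff F :=
    (hf.deriv.deriv.add ((hf.deriv.smooth_mul contDiff_const).add
      (hf.smooth_mul contDiff_const))).exp_mul _
  have hexp (t : ℝ) : Real.exp (-2 * t) * Real.exp (β * t) = Real.exp ((β - 2) * t) := by
    rw [← Real.exp_add]; ring_nf
  have key (x : EuclideanSpace ℝ (Fin n)) :
      ‖x‖ ^ α * lap (fun y ↦ g (Real.log ‖y‖) * P y) x ^ 2 =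
        (fun t ↦ Real.exp (α * t) * F t ^ 2) (Real.log ‖x‖) * P x ^ 2 := by
    have h1 : lap (fun y ↦ g (Real.log ‖y‖) * P y) x = F (Real.log ‖x‖) * P x := by
      rw [lap_log_norm_mul hg hP (fderiv_apply_self_of_homogeneous hP hk), hlap, hg_def,
        hf.deriv_deriv_exp_mul, hf.deriv_exp_mul]
      simp only [hF, ← hexp]
      ring
    rw [h1]
    linear_combination F (Real.log ‖x‖) * P x ^ 2 * hFc.rpow_norm_mul α x
  simp_rw [key]
  rw [integral_log_norm_mul_homogeneous hn (2 * k) (fun t ↦ Real.exp (α * t) * F t ^ 2)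
    (fun x ↦ P x ^ 2)
    (fun r x _ ↦ by rw [hk]; ring)]
  congr 1
  congr 1 with t
  have h2 : Real.exp ((n + (2 * k : ℕ)) * t) * (Real.exp (α * t) * Real.exp ((β - 2) * t) ^ 2) =
      1 := by
    rw [← Real.exp_nat_mul, ← Real.exp_add, ← Real.exp_add, ← Real.exp_zero]
    congr 1
    push_cast
    linear_combination t * hβ
  simp only [hF]
  linear_combination (deriv (deriv f) t + (n - 2 + 2 * k + 2 * β) * deriv f t +
    β * (β + (n - 2 + 2 * k)) * f t) ^ 2 * h2

theorem integral_rpow_mul_gradient_sq (hn : 1 ≤ n) (hP : ContDiff ℝ 2 P)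
    (hk : ∀ (r : ℝ) x, P (r • x) = r ^ k * P x) (hlap : ∀ x, lap P x = 0) (hf : IsLogCutoff f)
    (hβ : α - 4 + n + 2 * k + 2 * β = 0) :
    ∫ x, ‖x‖ ^ (α - 2) *
        ‖gradient (fun y ↦ (fun t ↦ Real.exp (β * t) * f t) (Real.log ‖y‖) * P y) x‖ ^ 2 =
      (∫ ω : Metric.sphere (0 : EuclideanSpace ℝ (Fin n)) 1, P ω ^ 2 ∂Measure.toSphere volume) *
        ∫ t, (deriv f t ^ 2 + 2 * (β + k) * (f t * deriv f t) +
          (β ^ 2 + 2 * k * β + k * (n - 2 + 2 * k)) * f t ^ 2) := by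
  set g : ℝ → ℝ := fun t ↦ Real.exp (β * t) * f t with hg_def
  have hg : IsLogCutoff g := hf.exp_mul β
  have hsq : ContDiff ℝ 2 fun x ↦ P x ^ 2 := hP.pow 2
  have hksq (r : ℝ) (x) : P (r • x) ^ 2 = r ^ (2 * k) * P x ^ 2 := by rw [hk]; ring
  have hΓ (x) : lap (fun y ↦ P y ^ 2) x =
      2 * ∑ i, fderiv ℝ P x (EuclideanSpace.single i 1) ^ 2 := by
    rw [lap_sq hP, hlap]; ring
  have hΓhom (r : ℝ) (x) (_ : 0 < r) :
      ‖r • x‖ ^ 2 * lap (fun y ↦ P y ^ 2) (r • x) =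
        r ^ (2 * k) * (‖x‖ ^ 2 * lap (fun y ↦ P y ^ 2) x) := by
    rw [hΓ, hΓ, norm_smul, mul_pow, Real.norm_eq_abs, sq_abs]
    linear_combination 2 * ‖x‖ ^ 2 * sum_fderiv_sq_of_homogeneous hk r x
  have hS := integral_sphere_lap hn hsq hksq hΓhom
  set F : ℝ → ℝ := fun t ↦ Real.exp ((α - 4) * t) *
    (Real.exp (2 * β * t) * ((deriv f t + β * f t) * (deriv f t + β * f t) +
      (2 * k) * f t * (deriv f t + β * f t))) with hF
  set H : ℝ → ℝ := fun t ↦ Real.exp ((α - 4) * t) * (Real.exp (2 * β * t) * (f t * f t / 2))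
    with hH
  have hf1 : IsLogCutoff fun t ↦ deriv f t + β * f t :=
    hf.deriv.add (hf.smooth_mul contDiff_const)
  have hFc : IsLogCutoff F :=
    ((hf1.smooth_mul hf1.smooth).add
      (hf1.smooth_mul (contDiff_const.mul hf.smooth))).exp_mul _ |>.exp_mul _
  have hHc : IsLogCutoff H := by
    have := ((hf.smooth_mul (hf.smooth.mul (contDiff_const (c := (1 / 2 : ℝ))))).exp_mul
      (2 * β)).exp_mul (α - 4)
    convert! this using 1
    ext t
    simp only [hH]
    ring
  have key (x : EuclideanSpace ℝ (Fin n)) :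
      ‖x‖ ^ (α - 2) * ‖gradient (fun y ↦ g (Real.log ‖y‖) * P y) x‖ ^ 2 =
        F (Real.log ‖x‖) * P x ^ 2 +
          H (Real.log ‖x‖) * (‖x‖ ^ 2 * lap (fun y ↦ P y ^ 2) x) := by
    have h1 := hg.rpow_norm_mul (α - 2) x
    have h2 := hg.deriv.rpow_norm_mul (α - 2) x
    rw [norm_gradient_log_norm_mul_sq hg hP (fderiv_apply_self_of_homogeneous hP hk), hΓ]
    set t := Real.log ‖x‖
    set Γ := ∑ i, fderiv ℝ P x (EuclideanSpace.single i 1) ^ 2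
    have e1 : Real.exp ((α - 4) * t) = Real.exp ((α - 2) * t) * Real.exp (-2 * t) := by
      rw [← Real.exp_add]; ring_nf
    have e2 : Real.exp (2 * β * t) = Real.exp (β * t) ^ 2 := by
      rw [← Real.exp_nat_mul]; push_cast; ring_nf
    have hFt : F t = Real.exp ((α - 2) * t) * Real.exp (-2 * t) *
        (deriv g t ^ 2 + 2 * k * (g t * deriv g t)) := by
      simp only [hF, hg_def, hf.deriv_exp_mul, e1, e2]
      ring
    have hHt : H t = Real.exp ((α - 2) * t) * Real.exp (-2 * t) * (g t ^ 2 / 2) := by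
      simp only [hH, hg_def, e1, e2]
      ring
    rw [hFt, hHt]
    linear_combination Real.exp (-2 * t) * (deriv g t + 2 * k * g t) * P x ^ 2 * h2 +
      Real.exp (-2 * t) * g t * (‖x‖ ^ 2 * Γ) * h1
  have hcl : Continuous (lap fun y ↦ P y ^ 2) := by
    have h1 : Continuous (fderiv ℝ P) := hP.continuous_fderiv (by simp)
    rw [funext hΓ]
    fun_prop
  simp_rw [key]
  rw [integral_add (hFc.integrable_comp_log_norm_mul hsq.continuous)
    (hHc.integrable_comp_log_norm_mul (by fun_prop)),
    integral_log_norm_mul_homogeneous hn (2 * k) F _ (fun r x _ ↦ hksq r x),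
    integral_log_norm_mul_homogeneous hn (2 * k) H _ hΓhom, hS]
  have hexp (t : ℝ) : Real.exp ((n + (2 * k : ℕ)) * t) *
      (Real.exp ((α - 4) * t) * Real.exp (2 * β * t)) = 1 := by
    rw [← Real.exp_add, ← Real.exp_add, ← Real.exp_zero]
    congr 1
    push_cast
    linear_combination t * hβ
  have hIF : ∫ t, Real.exp ((n + (2 * k : ℕ)) * t) * F t =
      ∫ t, ((deriv f t + β * f t) * (deriv f t + β * f t) +
        (2 * k) * f t * (deriv f t + β * f t)) := by
    congr 1 with t
    simp only [hF]
    linear_combination ((deriv f t + β * f t) * (deriv f t + β * f t) +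
      (2 * k) * f t * (deriv f t + β * f t)) * hexp t
  have hIH : ∫ t, Real.exp ((n + (2 * k : ℕ)) * t) * H t = ∫ t, (1 / 2 * f t) * f t := by
    congr 1 with t
    simp only [hH]
    linear_combination (f t * f t / 2) * hexp t
  have hI1 : IsLogCutoff fun t ↦ (deriv f t + β * f t) * (deriv f t + β * f t) +
      (2 * k) * f t * (deriv f t + β * f t) :=
    (hf1.smooth_mul hf1.smooth).add (hf1.smooth_mul (contDiff_const.mul hf.smooth))
  have hI2 : IsLogCutoff fun t ↦ (1 / 2 * f t) * f t :=
    hf.smooth_mul (contDiff_const.mul hf.smooth)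
  rw [hIF, hIH]
  have hsplit : ∫ t, (deriv f t ^ 2 + 2 * (β + k) * (f t * deriv f t) +
      (β ^ 2 + 2 * k * β + k * (n - 2 + 2 * k)) * f t ^ 2) =
      (∫ t, ((deriv f t + β * f t) * (deriv f t + β * f t) +
        (2 * k) * f t * (deriv f t + β * f t))) +
      (∫ t, (1 / 2 * f t) * f t) * ((2 * k : ℕ) * (n + (2 * k : ℕ) - 2)) := by
    rw [← integral_mul_const, ← integral_add hI1.integrable (hI2.integrable.mul_const _)]
    congr 1 with t
    push_cast
    ring
  rw [hsplit]
  ring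

end Energy

theorem IsLogCutoff.continuous_integral_of_eq_zero {f : ℝ → ℝ} (hf : IsLogCutoff f)
    {Φ : ℝ → ℝ → ℝ} (hΦ : Continuous (Function.uncurry Φ))
    (h0 : ∀ s t, f t = 0 → _root_.deriv f t = 0 → _root_.deriv (_root_.deriv f) t = 0 →
      Φ s t = 0) :
    Continuous fun s ↦ ∫ t, Φ s t := by
  obtain ⟨M₀, h₀⟩ := hf.eq_zero_of_large
  obtain ⟨M₁, h₁⟩ := hf.deriv.eq_zero_of_large
  obtain ⟨M₂, h₂⟩ := hf.deriv.deriv.eq_zero_of_large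
  rw [← continuousOn_univ]
  refine continuousOn_integral_of_compact_support
    (isCompact_Icc (a := (1 : ℝ)) (b := max M₀ (max M₁ M₂))) hΦ.continuousOn
    fun s t _ ht ↦ ?_
  rcases lt_or_ge t 1 with h | h
  · exact h0 s t (hf.eq_zero_of_lt_one t h) (hf.deriv.eq_zero_of_lt_one t h)
      (hf.deriv.deriv.eq_zero_of_lt_one t h)
  · have hM : max M₀ (max M₁ M₂) < t := by
      by_contra h'
      exact ht ⟨h, not_lt.1 h'⟩
    simp only [max_lt_iff] at hM
    exact h0 s t (h₀ t hM.1) (h₁ t hM.2.1) (h₂ t hM.2.2)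

theorem exists_slow_cutoff {κ C : ℝ} (hκ : 0 < κ) (b c σ : ℝ) (hC : c ^ 2 < C * κ) :
    ∃ f, IsLogCutoff f ∧
      0 < ∫ t, (deriv f t ^ 2 + 2 * σ * (f t * deriv f t) + κ * f t ^ 2) ∧
      ∫ t, (deriv (deriv f) t + b * deriv f t + c * f t) ^ 2 <
        C * ∫ t, (deriv f t ^ 2 + 2 * σ * (f t * deriv f t) + κ * f t ^ 2) := by
  obtain ⟨f, hf, -, hpos⟩ := exists_isLogCutoff
  have c0 : Continuous f := hf.smooth.continuous
  have c1 : Continuous (deriv f) := hf.deriv.smooth.continuous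
  have c2 : Continuous (deriv (deriv f)) := hf.deriv.deriv.smooth.continuous
  set J : ℝ → ℝ := fun s ↦ ∫ t, (s ^ 2 * deriv (deriv f) t + b * (s * deriv f t) + c * f t) ^ 2
    with hJ
  set K : ℝ → ℝ := fun s ↦
    ∫ t, ((s * deriv f t) ^ 2 + 2 * σ * (f t * (s * deriv f t)) + κ * f t ^ 2) with hK
  have hJc : Continuous J :=
    hf.continuous_integral_of_eq_zero (by unfold Function.uncurry; fun_prop)
      fun s t h₀ h₁ h₂ ↦ by simp [h₀, h₁, h₂]
  have hKc : Continuous K :=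
    hf.continuous_integral_of_eq_zero (by unfold Function.uncurry; fun_prop)
      fun s t h₀ h₁ _ ↦ by simp [h₀, h₁]
  have hJ0 : J 0 = c ^ 2 * ∫ t, f t ^ 2 := by simp [hJ, mul_pow, integral_const_mul]
  have hK0 : K 0 = κ * ∫ t, f t ^ 2 := by simp [hK, integral_const_mul]
  have ev1 : ∀ᶠ s in nhds 0, 0 < K s :=
    hKc.continuousAt.eventually_const_lt (by rw [hK0]; positivity)
  have ev2 : ∀ᶠ s in nhds 0, J s < C * K s := by
    refine hJc.continuousAt.eventually_lt (hKc.const_mul C).continuousAt ?_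
    simp only [hJ0, hK0]
    nlinarith
  have ev3 : ∀ᶠ s : ℝ in nhdsWithin 0 (Set.Ioi 0), 0 < s ∧ s ≤ 1 := by
    filter_upwards [Ioc_mem_nhdsGT one_pos] with s hs using hs
  obtain ⟨s, ⟨hK', hJ'⟩, hs, hs1⟩ :=
    (((ev1.and ev2).filter_mono nhdsWithin_le_nhds).and ev3).exists
  have d1 : deriv (fun t ↦ f (s * t)) = fun t ↦ s * deriv f (s * t) := by
    ext t
    exact deriv_comp_mul_left s f t
  have d2 : deriv (deriv fun t ↦ f (s * t)) = fun t ↦ s ^ 2 * deriv (deriv f) (s * t) := by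
    ext t
    rw [d1, deriv_const_mul_field, deriv_comp_mul_left s (deriv f) t, smul_eq_mul]
    ring
  have hs' : 0 < |s⁻¹| := abs_pos.2 (inv_ne_zero hs.ne')
  have iK := Measure.integral_comp_mul_left (fun t ↦
    (s * deriv f t) ^ 2 + 2 * σ * (f t * (s * deriv f t)) + κ * f t ^ 2) s
  have iJ := Measure.integral_comp_mul_left (fun t ↦
    (s ^ 2 * deriv (deriv f) t + b * (s * deriv f t) + c * f t) ^ 2) s
  refine ⟨fun t ↦ f (s * t), hf.comp_mul_left hs hs1, ?_, ?_⟩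
  · rw [d1, iK]
    exact mul_pos hs' hK'
  · rw [d2, d1, iK, iJ, smul_eq_mul, smul_eq_mul, mul_left_comm]
    exact mul_lt_mul_of_pos_left hJ' hs'

theorem statement12 (n : ℕ) (hn : 2 ≤ n) (α : ℝ) (hα : α ≠ 4 - (n : ℝ))
    (γ h : ℝ)
    (hγ : γ = ((n : ℝ) - 4 + α) * ((n : ℝ) - α) / 4)
    (hh : h = (((n : ℝ) - 4 + α) / 2) ^ 2)
    (k : ℕ) (ε : ℝ) (hε : 0 < ε) :
    ∃ u : EuclideanSpace ℝ (Fin n) → ℝ,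
      ContDiff ℝ 2 u ∧ HasCompactSupport u ∧
      (0 : EuclideanSpace ℝ (Fin n)) ∉ tsupport u ∧
      (∫ x : EuclideanSpace ℝ (Fin n), ‖x‖ ^ (α - 2) * ‖gradient u x‖ ^ 2) ≠ 0 ∧
      (∫ x : EuclideanSpace ℝ (Fin n), ‖x‖ ^ α * (lap u x) ^ 2) <
        ((γ + (k : ℝ) * ((n : ℝ) - 2 + (k : ℝ))) ^ 2 /
            (h + (k : ℝ) * ((n : ℝ) - 2 + (k : ℝ))) + ε) *
          (∫ x : EuclideanSpace ℝ (Fin n), ‖x‖ ^ (α - 2) * ‖gradient u x‖ ^ 2) := by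
  obtain ⟨P, hP, hk, hlap, ⟨x₀, hx₀, hPx₀⟩⟩ := exists_harmonic_homogeneous hn k
  have hn1 : 1 ≤ n := by omega
  have hn2 : (2 : ℝ) ≤ n := by exact_mod_cast hn
  have hA : 0 < ∫ ω : Metric.sphere (0 : EuclideanSpace ℝ (Fin n)) 1,
      P ω ^ 2 ∂Measure.toSphere volume := by
    refine Continuous.integral_pos_of_hasCompactSupport_nonneg_nonzero
      (x := ⟨x₀, mem_sphere_zero_iff_norm.2 hx₀⟩)
      ((hP.continuous.comp continuous_subtype_val).pow 2)
      (HasCompactSupport.of_compactSpace _) (fun ω ↦ sq_nonneg _) (pow_ne_zero 2 hPx₀)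
  set β : ℝ := -(α - 4 + n + 2 * k) / 2 with hβ
  have hβ' : α - 4 + n + 2 * k + 2 * β = 0 := by rw [hβ]; ring
  have hκ : 0 < h + k * (n - 2 + k) := by
    have h1 : (n : ℝ) - 4 + α ≠ 0 := fun h0 ↦ hα (by linarith)
    have h2 : 0 < h := by rw [hh]; positivity
    have h3 : 0 ≤ (k : ℝ) * (n - 2 + k) := by
      have := Nat.cast_nonneg (α := ℝ) k
      exact mul_nonneg this (by linarith)
    linarith
  have hκ' : β ^ 2 + 2 * k * β + k * (n - 2 + 2 * k) = h + k * (n - 2 + k) := by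
    rw [hβ, hh]; ring
  have hc : β * (β + (n - 2 + 2 * k)) = -(γ + k * (n - 2 + k)) := by
    rw [hβ, hγ]; ring
  obtain ⟨f, hf, hpos, hlt⟩ := exists_slow_cutoff
    (C := (γ + k * (n - 2 + k)) ^ 2 / (h + k * (n - 2 + k)) + ε) hκ
    (n - 2 + 2 * k + 2 * β) (β * (β + (n - 2 + 2 * k))) (β + k) (by
      rw [hc, add_mul, div_mul_cancel₀ _ hκ.ne', neg_sq]
      nlinarith)
  have hg := hf.exp_mul β
  refine ⟨fun y ↦ (fun t ↦ Real.exp (β * t) * f t) (Real.log ‖y‖) * P y,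
    contDiff_log_norm_mul hg hP, hg.hasCompactSupport P, hg.zero_notMem_tsupport P, ?_, ?_⟩
  · rw [integral_rpow_mul_gradient_sq hn1 hP hk hlap hf hβ', hκ']
    exact (mul_pos hA hpos).ne'
  · rw [integral_rpow_mul_gradient_sq hn1 hP hk hlap hf hβ',
      integral_rpow_mul_lap_sq hn1 hP hk hlap hf hβ', hκ', mul_left_comm]
    exact mul_lt_mul_of_pos_left hlt hA
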